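/- Let S be the string rewriting system constructed from a given GPCP instance as described. Then there exist strings W_1, W_2 ∈ Σ̂* such that ¢_1 W_1 ↔*_S W_2 and ¢_2 W_1 ↔*_S W_2 if and only if the GPCP instance has a solution. (This is the correctness of the reduction showing the Common Equation problem is undecidable for dwindling convergent string rewriting systems.) -/

import Mathlib

/-- The two-letter alphabet Γ = {a, b} of the GPCP instance. -/
inductive Γ : Type where
  | a : Γ
  | b : Γ

/-- The alphabet Σ̂ = {a₁,a₂,a₃,b₁,b₂,b₃,¢₁,¢₂,B} ∪ {c₀,…,c_{n+1}}. -/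
inductive Ltr (n : ℕ) : Type where
  | a1 : Ltr n
  | a2 : Ltr n
  | a3 : Ltr n
  | b1 : Ltr n
  | b2 : Ltr n
  | b3 : Ltr n
  | cent1 : Ltr n
  | cent2 : Ltr n
  | B : Ltr n
  | c : Fin (n + 2) → Ltr n

/-- The homomorphism h₁ : Γ* → Σ̂*, h₁(a) = a₁a₂a₃, h₁(b) = b₁b₂b₃. -/
def h1 {n : ℕ} (w : List Γ) : List (Ltr n) :=
  w.flatMap fun g => match g with
    | Γ.a => [Ltr.a1, Ltr.a2, Ltr.a3]
    | Γ.b => [Ltr.b1, Ltr.b2, Ltr.b3]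

/-- The homomorphism h₂ : Γ* → Σ̂*, h₂(a) = a₁a₂, h₂(b) = b₁b₂. -/
def h2 {n : ℕ} (w : List Γ) : List (Ltr n) :=
  w.flatMap fun g => match g with
    | Γ.a => [Ltr.a1, Ltr.a2]
    | Γ.b => [Ltr.b1, Ltr.b2]

/-- The homomorphism h₃ : Γ* → Σ̂*, h₃(a) = a₁, h₃(b) = b₁. -/
def h3 {n : ℕ} (w : List Γ) : List (Ltr n) :=
  w.flatMap fun g => match g with
    | Γ.a => [Ltr.a1]
    | Γ.b => [Ltr.b1]

/-- One-step rewrite relation of a string rewriting system `R`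
(a set of rules `(l, r)`): `u →_R v` iff `u = x l y` and `v = x r y`. -/
def OneStep {α : Type*} (R : Set (List α × List α)) (u v : List α) : Prop :=
  ∃ x y l r : List α, (l, r) ∈ R ∧ u = x ++ l ++ y ∧ v = x ++ r ++ y

/-- `u →*_R v`: reflexive-transitive closure of the one-step rewrite relation. -/
def RewStar {α : Type*} (R : Set (List α × List α)) : List α → List α → Prop :=
  Relation.ReflTransGen (OneStep R)

/-- `u ↔*_R v`: the Thue congruence, i.e. the reflexive-transitive-symmetric
closure of the one-step rewrite relation. -/
def ThueCong {α : Type*} (R : Set (List α × List α)) : List α → List α → Prop :=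
  Relation.EqvGen (OneStep R)

/-- The rules of the string rewriting system `S` constructed from the GPCP
instance with dominoes `(x i, y i)` for `i = 0, …, n+1`. -/
inductive SRule (n : ℕ) (x y : Fin (n + 2) → List Γ) :
    List (Ltr n) → List (Ltr n) → Prop where
  /- Class D rules -/
  | D1 (g : Γ) : SRule n x y ([Ltr.cent1] ++ h1 [g]) ([Ltr.cent1] ++ h3 [g])
  | D2 (g : Γ) : SRule n x y ([Ltr.cent2] ++ h1 [g]) ([Ltr.cent2] ++ h2 [g])
  | D3 (g g' : Γ) : SRule n x y (h2 [g] ++ h1 [g']) (h2 [g] ++ h2 [g'])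
  | D4 (g g' : Γ) : SRule n x y (h3 [g] ++ h1 [g']) (h3 [g] ++ h3 [g'])
  /- Class I rules -/
  | I1 : SRule n x y ([Ltr.cent1] ++ h3 (x 0) ++ [Ltr.B, Ltr.c 0]) []
  | I2 : SRule n x y ([Ltr.cent2] ++ h2 (y 0) ++ [Ltr.c 0]) []
  /- Class II rules -/
  | II1 (i : Fin (n + 2)) (hi : 1 ≤ (i : ℕ)) (hn : (i : ℕ) ≤ n) :
      SRule n x y (h3 (x i) ++ [Ltr.B, Ltr.c i]) []
  | II2 (i : Fin (n + 2)) (hi : 1 ≤ (i : ℕ)) (hn : (i : ℕ) ≤ n) :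
      SRule n x y (h2 (y i) ++ [Ltr.c i, Ltr.B]) []
  /- Class III rules -/
  | III1 : SRule n x y (h3 (x (Fin.last (n + 1))) ++ [Ltr.c (Fin.last (n + 1))]) []
  | III2 : SRule n x y (h2 (y (Fin.last (n + 1))) ++ [Ltr.c (Fin.last (n + 1)), Ltr.B]) []

/-- The string rewriting system `S` as a set of rules. -/
def SSys (n : ℕ) (x y : Fin (n + 2) → List Γ) : Set (List (Ltr n) × List (Ltr n)) :=
  {p | SRule n x y p.1 p.2}

/-- The GPCP instance `(x i, y i)_{i = 0,…,n+1}` (with start domino index `0`,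
end domino index `n+1` and intermediate dominoes `1,…,n`) has a solution:
a sequence of indices `i₁, …, i_k ∈ {1, …, n}` with
`x₀ x_{i₁} ⋯ x_{i_k} x_{n+1} = y₀ y_{i₁} ⋯ y_{i_k} y_{n+1}`. -/
def GPCPSolvable (n : ℕ) (x y : Fin (n + 2) → List Γ) : Prop :=
  ∃ L : List (Fin (n + 2)), (∀ i ∈ L, 1 ≤ (i : ℕ) ∧ (i : ℕ) ≤ n) ∧
    x 0 ++ L.flatMap x ++ x (Fin.last (n + 1)) =
      y 0 ++ L.flatMap y ++ y (Fin.last (n + 1))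

namespace CommonEquation

variable {n : ℕ}

/-- The letter `g₁`, `g₂` or `g₃` (for `k = 0, 1, 2`) of `Σ̂` attached to a letter `g` of `Γ`. -/
def sub : Fin 3 → Γ → Ltr n
  | 0, Γ.a => Ltr.a1
  | 1, Γ.a => Ltr.a2
  | 2, Γ.a => Ltr.a3
  | 0, Γ.b => Ltr.b1
  | 1, Γ.b => Ltr.b2
  | 2, Γ.b => Ltr.b3

@[simp] lemma sub_inj {j k : Fin 3} {g g' : Γ} :
    (sub j g : Ltr n) = sub k g' ↔ j = k ∧ g = g' := by
  fin_cases j <;> fin_cases k <;> cases g <;> cases g' <;> simp [sub]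

@[simp] lemma sub_ne_B (k : Fin 3) (g : Γ) : (sub k g : Ltr n) ≠ Ltr.B := by
  fin_cases k <;> cases g <;> simp [sub]

@[simp] lemma sub_ne_c (k : Fin 3) (g : Γ) (i : Fin (n + 2)) : sub k g ≠ Ltr.c i := by
  fin_cases k <;> cases g <;> simp [sub]

@[simp] lemma sub_ne_cent1 (k : Fin 3) (g : Γ) : (sub k g : Ltr n) ≠ Ltr.cent1 := by
  fin_cases k <;> cases g <;> simp [sub]

@[simp] lemma sub_ne_cent2 (k : Fin 3) (g : Γ) : (sub k g : Ltr n) ≠ Ltr.cent2 := by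
  fin_cases k <;> cases g <;> simp [sub]

@[simp] lemma B_ne_sub (k : Fin 3) (g : Γ) : (Ltr.B : Ltr n) ≠ sub k g := (sub_ne_B k g).symm

@[simp] lemma c_ne_sub (k : Fin 3) (g : Γ) (i : Fin (n + 2)) : Ltr.c i ≠ sub k g :=
  (sub_ne_c k g i).symm

@[simp] lemma cent1_ne_sub (k : Fin 3) (g : Γ) : (Ltr.cent1 : Ltr n) ≠ sub k g :=
  (sub_ne_cent1 k g).symm

@[simp] lemma cent2_ne_sub (k : Fin 3) (g : Γ) : (Ltr.cent2 : Ltr n) ≠ sub k g :=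
  (sub_ne_cent2 k g).symm

@[simp] lemma h1_nil : (h1 [] : List (Ltr n)) = [] := rfl

@[simp] lemma h2_nil : (h2 [] : List (Ltr n)) = [] := rfl

@[simp] lemma h3_nil : (h3 [] : List (Ltr n)) = [] := rfl

@[simp] lemma h1_cons (g : Γ) (w : List Γ) :
    (h1 (g :: w) : List (Ltr n)) = sub 0 g :: sub 1 g :: sub 2 g :: h1 w := by
  cases g <;> simp [h1, sub]

@[simp] lemma h2_cons (g : Γ) (w : List Γ) :
    (h2 (g :: w) : List (Ltr n)) = sub 0 g :: sub 1 g :: h2 w := by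
  cases g <;> simp [h2, sub]

@[simp] lemma h3_cons (g : Γ) (w : List Γ) :
    (h3 (g :: w) : List (Ltr n)) = sub 0 g :: h3 w := by
  cases g <;> simp [h3, sub]

@[simp] lemma h2_append (u v : List Γ) : (h2 (u ++ v) : List (Ltr n)) = h2 u ++ h2 v := by
  simp [h2]

@[simp] lemma h3_append (u v : List Γ) : (h3 (u ++ v) : List (Ltr n)) = h3 u ++ h3 v := by
  simp [h3]

/-- The pairs of adjacent letters that occur in left-hand sides of rules only at the very end. -/
def Terminal (z t : Ltr n) : Prop :=
  (∃ g, z = sub 1 g ∧ t = sub 2 g) ∨ (∃ i, z = Ltr.B ∧ t = Ltr.c i) ∨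
    (∃ i, z = Ltr.c i ∧ t = Ltr.B) ∨ (∃ g, z = sub 1 g ∧ t = Ltr.c 0) ∨
    ∃ g, z = sub 0 g ∧ t = Ltr.c (Fin.last (n + 1))

lemma head?_h3_append (v : List Γ) (e : List (Ltr n)) :
    ∀ t ∈ (h3 v ++ e).head?, (∃ g, t = sub 0 g) ∨ t ∈ e.head? := by
  cases v with
  | nil => exact fun t ht => Or.inr ht
  | cons => simp

lemma head?_h2_append (v : List Γ) (e : List (Ltr n)) :
    ∀ t ∈ (h2 v ++ e).head?, (∃ g, t = sub 0 g) ∨ t ∈ e.head? := by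
  cases v with
  | nil => exact fun t ht => Or.inr ht
  | cons => simp

lemma isChain_h3_append (v : List Γ) {e : List (Ltr n)}
    (he : e.IsChain fun z t => ¬Terminal z t)
    (h : ∀ g, ∀ t ∈ e.head?, ¬Terminal (sub 0 g) t) :
    (h3 v ++ e).IsChain fun z t => ¬Terminal z t := by
  induction v with
  | nil => simpa
  | cons g v ih =>
    rw [h3_cons, List.cons_append, List.isChain_cons]
    refine ⟨fun t ht => ?_, ih⟩
    obtain ⟨g', rfl⟩ | ht := head?_h3_append v e t ht
    · simp [Terminal]
    · exact h g t ht

lemma isChain_h2_append (v : List Γ) {e : List (Ltr n)}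
    (he : e.IsChain fun z t => ¬Terminal z t)
    (h : ∀ g, ∀ t ∈ e.head?, ¬Terminal (sub 1 g) t) :
    (h2 v ++ e).IsChain fun z t => ¬Terminal z t := by
  induction v with
  | nil => simpa
  | cons g v ih =>
    rw [h2_cons, List.cons_append, List.cons_append, List.isChain_cons_cons, List.isChain_cons]
    refine ⟨by simp [Terminal], fun t ht => ?_, ih⟩
    obtain ⟨g', rfl⟩ | ht := head?_h2_append v e t ht
    · simp [Terminal]
    · exact h g t ht

lemma isChain_cent1_h3_append (v : List Γ) {e : List (Ltr n)}
    (he : e.IsChain fun z t => ¬Terminal z t)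
    (h : ∀ g, ∀ t ∈ e.head?, ¬Terminal (sub 0 g) t) :
    (Ltr.cent1 :: (h3 v ++ e)).IsChain fun z t => ¬Terminal z t :=
  List.isChain_cons.2 ⟨by simp [Terminal], isChain_h3_append v he h⟩

lemma isChain_cent2_h2_append (v : List Γ) {e : List (Ltr n)}
    (he : e.IsChain fun z t => ¬Terminal z t)
    (h : ∀ g, ∀ t ∈ e.head?, ¬Terminal (sub 1 g) t) :
    (Ltr.cent2 :: (h2 v ++ e)).IsChain fun z t => ¬Terminal z t :=
  List.isChain_cons.2 ⟨by simp [Terminal], isChain_h2_append v he h⟩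

variable {x y : Fin (n + 2) → List Γ} {l r : List (Ltr n)}

lemma _root_.SRule.exists_eq_append (h : SRule n x y l r) : ∃ m, m ≠ [] ∧ l = r ++ m := by
  cases h <;> simp

lemma _root_.SRule.isChain_dropLast (h : SRule n x y l r) :
    l.dropLast.IsChain fun z t => ¬Terminal z t := by
  cases h with
  | D1 g => simp [Terminal]
  | D2 g => simp [Terminal]
  | D3 g g' => simp [Terminal]
  | D4 g g' => simp [Terminal]
  | I1 =>
    simpa [List.dropLast_cons_of_ne_nil] using
      isChain_cent1_h3_append (x 0) (e := [Ltr.B]) (by simp) (by simp [Terminal])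
  | I2 =>
    simpa [List.dropLast_cons_of_ne_nil] using
      isChain_cent2_h2_append (y 0) (e := []) (by simp) (by simp)
  | II1 i hi hn =>
    simpa using isChain_h3_append (x i) (e := [Ltr.B]) (by simp) (by simp [Terminal])
  | II2 i hi hn =>
    have : i ≠ 0 := by rintro rfl; simp at hi
    simpa using isChain_h2_append (y i) (e := [Ltr.c i]) (by simp) (by simp [Terminal, this])
  | III1 => simpa using isChain_h3_append (x _) (e := []) (by simp) (by simp)
  | III2 =>
    simpa using isChain_h2_append (y _) (e := [Ltr.c (Fin.last (n + 1))]) (by simp)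
      (by simp [Terminal])

lemma _root_.SRule.not_terminal_head (h : SRule n x y l r) {t : Ltr n} {m : List (Ltr n)}
    (hl : l = t :: m) (hx : ∀ i, x i ≠ []) (hy : ∀ i, y i ≠ []) (z : Ltr n) :
    ¬Terminal z t := by
  have hd : ∀ v : List Γ, v ≠ [] → ∃ g u, v = g :: u := fun v hv => by
    cases v <;> simp_all
  have key : (∃ g, t = sub 0 g) ∨ t = Ltr.cent1 ∨ t = Ltr.cent2 := by
    cases h with
    | II1 i => obtain ⟨g, u, e⟩ := hd _ (hx i); simp [e] at hl; simp [← hl.1]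
    | II2 i => obtain ⟨g, u, e⟩ := hd _ (hy i); simp [e] at hl; simp [← hl.1]
    | III1 => obtain ⟨g, u, e⟩ := hd _ (hx (Fin.last _)); simp [e] at hl; simp [← hl.1]
    | III2 => obtain ⟨g, u, e⟩ := hd _ (hy (Fin.last _)); simp [e] at hl; simp [← hl.1]
    | _ => simp at hl; simp [← hl.1]
  obtain ⟨g, rfl⟩ | rfl | rfl := key <;> simp [Terminal]

lemma exists_eq_concat {x : Fin (n + 2) → List Γ} (hx : ∀ i, x i ≠ []) :
    ∃ (u : Fin (n + 2) → List Γ) (g : Fin (n + 2) → Γ), x = fun i => u i ++ [g i] :=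
  ⟨fun i => (x i).dropLast, fun i => (x i).getLast (hx i), by
    funext i; exact (List.dropLast_append_getLast (hx i)).symm⟩

lemma _root_.SRule.exists_terminal (h : SRule n x y l r) (hx : ∀ i, x i ≠ []) (hy : ∀ i, y i ≠ []) :
    ∃ m z t, l = m ++ [z, t] ∧ Terminal z t := by
  obtain ⟨u, g, rfl⟩ := exists_eq_concat hx
  obtain ⟨v, f, rfl⟩ := exists_eq_concat hy
  cases h with
  | D1 g => exact ⟨[Ltr.cent1, sub 0 g], sub 1 g, sub 2 g, by simp, by simp [Terminal]⟩
  | D2 g => exact ⟨[Ltr.cent2, sub 0 g], sub 1 g, sub 2 g, by simp, by simp [Terminal]⟩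
  | D3 g' g =>
    exact ⟨[sub 0 g', sub 1 g', sub 0 g], sub 1 g, sub 2 g, by simp, by simp [Terminal]⟩
  | D4 g' g => exact ⟨[sub 0 g', sub 0 g], sub 1 g, sub 2 g, by simp, by simp [Terminal]⟩
  | I1 => exact ⟨_, _, _, rfl, by simp [Terminal]⟩
  | II1 => exact ⟨_, _, _, rfl, by simp [Terminal]⟩
  | II2 => exact ⟨_, _, _, rfl, by simp [Terminal]⟩
  | III2 => exact ⟨_, _, _, rfl, by simp [Terminal]⟩
  | I2 =>
    exact ⟨[Ltr.cent2] ++ h2 (v 0) ++ [sub 0 (f 0)], sub 1 (f 0), Ltr.c 0, by simp,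
      by simp [Terminal]⟩
  | III1 =>
    exact ⟨h3 (u (Fin.last _)), sub 0 (g (Fin.last _)), Ltr.c (Fin.last _), by simp,
      by simp [Terminal]⟩

lemma _root_.SRule.eq_of_suffix {l' r' p q : List (Ltr n)} (h : SRule n x y l r)
    (h' : SRule n x y l' r') (hx : ∀ i, x i ≠ []) (hy : ∀ i, y i ≠ [])
    (e : p ++ l = q ++ l') : l = l' ∧ r = r' := by
  obtain ⟨u, g, rfl⟩ := exists_eq_concat hx
  obtain ⟨v, f, rfl⟩ := exists_eq_concat hy
  have e' := congrArg List.reverse e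
  cases h <;> cases h' <;> simp at e' ⊢ <;> simp_all
  rename_i hi hn
  simp [← e'.1] at hi

/-- A string is reducible if some left-hand side of a rule occurs in it. -/
def Reducible (x y : Fin (n + 2) → List Γ) (u : List (Ltr n)) : Prop :=
  ∃ p l q r, SRule n x y l r ∧ u = p ++ l ++ q

lemma Reducible.append_left {u : List (Ltr n)} (h : Reducible x y u) (s : List (Ltr n)) :
    Reducible x y (s ++ u) := by
  obtain ⟨p, l, q, r, hl, rfl⟩ := h
  exact ⟨s ++ p, l, q, r, hl, by simp⟩

lemma Reducible.append_right {u : List (Ltr n)} (h : Reducible x y u) (s : List (Ltr n)) :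
    Reducible x y (u ++ s) := by
  obtain ⟨p, l, q, r, hl, rfl⟩ := h
  exact ⟨p, l, q ++ s, r, hl, by simp⟩

lemma not_reducible_of_isChain {u : List (Ltr n)} (hx : ∀ i, x i ≠ []) (hy : ∀ i, y i ≠ [])
    (h : u.IsChain fun z t => ¬Terminal z t) : ¬Reducible x y u := by
  rintro ⟨p, l, q, r, hl, rfl⟩
  obtain ⟨m, z, t, rfl, hzt⟩ := hl.exists_terminal hx hy
  have h1 := h.left_of_append.right_of_append.right_of_append
  exact (List.isChain_cons_cons.1 h1).1 hzt

/-- A redex in `s ++ u` with `s` and `u` irreducible straddles the border. -/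
lemma exists_straddle {s u : List (Ltr n)} (hs : ¬Reducible x y s) (hu : ¬Reducible x y u)
    (h : Reducible x y (s ++ u)) :
    ∃ p a b q r, a ≠ [] ∧ b ≠ [] ∧ SRule n x y (a ++ b) r ∧ s = p ++ a ∧ u = b ++ q := by
  obtain ⟨p, l, q, r, hl, e⟩ := h
  rw [List.append_assoc, List.append_eq_append_iff] at e
  obtain ⟨m, rfl, rfl⟩ | ⟨m, rfl, e⟩ := e
  · exact absurd ⟨m, l, q, r, hl, by simp⟩ hu
  · rw [List.append_eq_append_iff] at e
    obtain ⟨k, rfl, rfl⟩ | ⟨k, rfl, rfl⟩ := e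
    · exact absurd ⟨p, l, k, r, hl, by simp⟩ hs
    · refine ⟨p, m, k, q, r, ?_, ?_, hl, rfl, rfl⟩
      · rintro rfl
        exact hu ⟨[], k, q, r, hl, by simp⟩
      · rintro rfl
        exact hs ⟨p, m, [], r, by simpa using hl, by simp⟩

/-- Appending a proper prefix of a left-hand side to an irreducible string creates no redex. -/
lemma not_reducible_append_of_rule {s l₁ l₂ r : List (Ltr n)} (hx : ∀ i, x i ≠ [])
    (hy : ∀ i, y i ≠ []) (hs : ¬Reducible x y s) (h : SRule n x y (l₁ ++ l₂) r)
    (h2 : l₂ ≠ []) : ¬Reducible x y (s ++ l₁) := by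
  intro hred
  have hl₁ : l₁.IsChain fun z t => ¬Terminal z t := by
    have := h.isChain_dropLast
    rw [List.dropLast_append_of_ne_nil h2] at this
    exact this.left_of_append
  obtain ⟨p, a, b, q, r', ha, hb, hr', rfl, rfl⟩ :=
    exists_straddle hs (not_reducible_of_isChain hx hy hl₁) hred
  obtain ⟨m, z, t, e, hzt⟩ := hr'.exists_terminal hx hy
  obtain ⟨b', t', rfl⟩ : ∃ b' t', b = b' ++ [t'] := by
    simpa using (List.eq_nil_or_concat b).resolve_left hb
  obtain ⟨e1, e2⟩ : a ++ b' = m ++ [z] ∧ t' = t := by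
    have : (a ++ b') ++ [t'] = (m ++ [z]) ++ [t] := by simpa using e
    simpa using List.append_inj' this rfl
  subst e2
  obtain rfl | ⟨b'', z', rfl⟩ := List.eq_nil_or_concat b'
  · exact h.not_terminal_head rfl hx hy z hzt
  · obtain ⟨-, rfl⟩ : a ++ b'' = m ∧ z' = z := by
      have : (a ++ b'') ++ [z'] = m ++ [z] := by simpa using e1
      simpa using List.append_inj' this rfl
    have := hl₁.left_of_append
    rw [List.concat_eq_append, List.append_assoc] at this
    exact (List.isChain_cons_cons.1 this.right_of_append).1 hzt

open Classical in
/-- One move of the left-to-right reduction machine: push the letter `t` on the stack `s` and, if a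
left-hand side is now a suffix of the stack, contract it. -/
noncomputable def push (x y : Fin (n + 2) → List Γ) (s : List (Ltr n)) (t : Ltr n) :
    List (Ltr n) :=
  if h : ∃ v p l r, SRule n x y l r ∧ s ++ [t] = p ++ l ∧ v = p ++ r then h.choose else s ++ [t]

lemma push_of_rule {p s : List (Ltr n)} {t : Ltr n} (hx : ∀ i, x i ≠ []) (hy : ∀ i, y i ≠ [])
    (h : SRule n x y l r) (e : s ++ [t] = p ++ l) : push x y s t = p ++ r := by
  have H : ∃ v p l r, SRule n x y l r ∧ s ++ [t] = p ++ l ∧ v = p ++ r := ⟨_, p, l, r, h, e, rfl⟩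
  rw [push, dif_pos H]
  obtain ⟨p', l', r', h', e', hv⟩ := H.choose_spec
  rw [hv]
  obtain ⟨rfl, rfl⟩ := h.eq_of_suffix h' hx hy (e.symm.trans e')
  rw [List.append_cancel_right (e.symm.trans e')]

lemma push_of_not_reducible {s : List (Ltr n)} {t : Ltr n} (h : ¬Reducible x y (s ++ [t])) :
    push x y s t = s ++ [t] := by
  rw [push, dif_neg]
  rintro ⟨_, p, l, r, hl, e, -⟩
  exact h ⟨p, l, [], r, hl, by simpa using e⟩

lemma push_cases (x y : Fin (n + 2) → List Γ) (s : List (Ltr n)) (t : Ltr n) :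
    (push x y s t = s ++ [t] ∧ ∀ p l r, SRule n x y l r → s ++ [t] ≠ p ++ l) ∨
      ∃ p l r, SRule n x y l r ∧ s ++ [t] = p ++ l ∧ push x y s t = p ++ r := by
  by_cases H : ∃ v p l r, SRule n x y l r ∧ s ++ [t] = p ++ l ∧ v = p ++ r
  · right
    rw [push, dif_pos H]
    exact H.choose_spec
  · left
    rw [push, dif_neg H]
    exact ⟨rfl, fun p l r h e => H ⟨_, p, l, r, h, e, rfl⟩⟩

lemma length_push_le (s : List (Ltr n)) (t : Ltr n) : (push x y s t).length ≤ s.length + 1 := by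
  obtain ⟨e, -⟩ | ⟨p, l, r, h, e, e'⟩ := push_cases x y s t
  · simp [e]
  · obtain ⟨m, -, rfl⟩ := h.exists_eq_append
    have := congrArg List.length e
    simp only [List.length_append, List.length_singleton] at this
    rw [e', List.length_append]
    omega

lemma length_foldl_push_le (u s : List (Ltr n)) :
    (u.foldl (push x y) s).length ≤ s.length + u.length := by
  induction u generalizing s with
  | nil => simp
  | cons t u ih =>
    have := ih (push x y s t)
    have := length_push_le (x := x) (y := y) s t
    simp only [List.foldl_cons, List.length_cons]
    omega

lemma not_reducible_push {s : List (Ltr n)} (hs : ¬Reducible x y s) (t : Ltr n) :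
    ¬Reducible x y (push x y s t) := by
  obtain ⟨e', H⟩ | ⟨p, l, r, h, e, e'⟩ := push_cases x y s t
  · rw [e']
    rintro ⟨p, l, q, r, h, e⟩
    obtain rfl | ⟨q, t', rfl⟩ := List.eq_nil_or_concat q
    · exact H p l r h (by simpa using e)
    · have : s ++ [t] = (p ++ l ++ q) ++ [t'] := by simpa using e
      exact hs ⟨p, l, q, r, h, (List.append_inj' this rfl).1⟩
  · obtain ⟨m, hm, rfl⟩ := h.exists_eq_append
    obtain ⟨m', t', rfl⟩ := (List.eq_nil_or_concat m).resolve_left hm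
    have : s ++ [t] = (p ++ r ++ m') ++ [t'] := by simpa using e
    rw [(List.append_inj' this rfl).1] at hs
    rw [e']
    exact fun h => hs (h.append_right m')

lemma not_reducible_foldl_push {s : List (Ltr n)} (hs : ¬Reducible x y s) (u : List (Ltr n)) :
    ¬Reducible x y (u.foldl (push x y) s) := by
  induction u generalizing s with
  | nil => exact hs
  | cons t u ih => exact ih (not_reducible_push hs t)

lemma foldl_push_of_not_reducible {s u : List (Ltr n)} (h : ¬Reducible x y (s ++ u)) :
    u.foldl (push x y) s = s ++ u := by
  induction u generalizing s with
  | nil => simp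
  | cons t u ih =>
    have hst : ¬Reducible x y (s ++ [t]) := fun H => h (by simpa using H.append_right u)
    rw [List.foldl_cons, push_of_not_reducible hst, ih (by simpa using h), List.append_assoc,
      List.singleton_append]

lemma not_reducible_nil (hx : ∀ i, x i ≠ []) (hy : ∀ i, y i ≠ []) :
    ¬Reducible x y ([] : List (Ltr n)) :=
  not_reducible_of_isChain hx hy (by simp)

lemma foldl_push_rule {s : List (Ltr n)} (hx : ∀ i, x i ≠ []) (hy : ∀ i, y i ≠ [])
    (hs : ¬Reducible x y s) (h : SRule n x y l r) :
    l.foldl (push x y) s = r.foldl (push x y) s := by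
  obtain ⟨m, hm, rfl⟩ := h.exists_eq_append
  obtain ⟨m', t, rfl⟩ := (List.eq_nil_or_concat m).resolve_left hm
  rw [List.concat_eq_append] at h ⊢
  rw [foldl_push_of_not_reducible (not_reducible_append_of_rule hx hy hs h (by simp)),
    ← List.append_assoc, List.foldl_append, foldl_push_of_not_reducible
      (not_reducible_append_of_rule (l₂ := [t]) hx hy hs (by simpa using h) (by simp))]
  exact push_of_rule hx hy h (by simp)

/-- The normal form of a string, computed by the left-to-right reduction machine. -/
noncomputable def nf (x y : Fin (n + 2) → List Γ) (u : List (Ltr n)) : List (Ltr n) :=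
  u.foldl (push x y) []

lemma nf_rule (hx : ∀ i, x i ≠ []) (hy : ∀ i, y i ≠ []) (h : SRule n x y l r)
    (p q : List (Ltr n)) : nf x y (p ++ l ++ q) = nf x y (p ++ r ++ q) := by
  simp only [nf, List.foldl_append]
  rw [foldl_push_rule hx hy (not_reducible_foldl_push (not_reducible_nil hx hy) p) h]

lemma nf_eq_of_thueCong (hx : ∀ i, x i ≠ []) (hy : ∀ i, y i ≠ []) {u v : List (Ltr n)}
    (h : ThueCong (SSys n x y) u v) : nf x y u = nf x y v := by
  induction h with
  | rel u v h =>
    obtain ⟨p, q, l, r, h, rfl, rfl⟩ := h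
    exact nf_rule hx hy h p q
  | refl => rfl
  | symm _ _ _ ih => exact ih.symm
  | trans _ _ _ _ _ ih₁ ih₂ => exact ih₁.trans ih₂

lemma nf_append {s : List (Ltr n)} (hs : ¬Reducible x y s) (u : List (Ltr n)) :
    nf x y (s ++ u) = u.foldl (push x y) s := by
  have := foldl_push_of_not_reducible (s := []) (by simpa using hs)
  rw [nf, List.foldl_append, this, List.nil_append]

lemma head?_foldl_push (e : Ltr n) (s u : List (Ltr n))
    (hs : s.head? = some e) : (u.foldl (push x y) s).head? = some e ∨
      (u.foldl (push x y) s).length ≤ u.length := by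
  induction u generalizing s with
  | nil => exact .inl hs
  | cons t u ih =>
    have key : (push x y s t).head? = some e ∨ push x y s t = [] := by
      obtain ⟨s, rfl⟩ : ∃ s', s = e :: s' := by
        cases s <;> simp_all
      obtain ⟨e1, -⟩ | ⟨p, l, r, h, e1, e2⟩ := push_cases x y (e :: s) t
      · simp [e1]
      · rw [e2]
        obtain ⟨m, -, rfl⟩ := h.exists_eq_append
        cases p with
        | cons => simp at e1 ⊢; exact e1.1.symm
        | nil =>
          cases r with
          | nil => simp
          | cons => simp at e1 ⊢; exact e1.1.symm
    rw [List.foldl_cons]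
    obtain h | h := key
    · exact (ih _ h).imp_right fun h => h.trans (by simp)
    · right
      have := length_foldl_push_le (x := x) (y := y) u (push x y s t)
      rw [h] at this ⊢
      simp at this ⊢
      omega

/-- If two stacks start with different end markers and reach the same normal form on the input `u`,
then the first one cannot be left untouched. -/
lemma reducible_of_nf_eq {e e' : Ltr n} (hne : e ≠ e')
    {s s' u : List (Ltr n)} (hs' : ¬Reducible x y (e' :: s'))
    (h : nf x y (e :: s ++ u) = nf x y (e' :: s' ++ u)) : Reducible x y (e :: s ++ u) := by
  by_contra H
  rw [nf_append hs', nf, foldl_push_of_not_reducible (by simpa using H)] at h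
  have := head?_foldl_push (x := x) (y := y) e' (e' :: s') u rfl
  rw [← h] at this
  simp [hne] at this

lemma mem_h2 {v : List Γ} {z : Ltr n} (h : z ∈ (h2 v : List (Ltr n))) :
    ∃ g, z = sub 0 g ∨ z = sub 1 g := by
  induction v with
  | nil => simp at h
  | cons g v ih =>
    simp at h
    obtain h | h | h := h
    exacts [⟨g, .inl h⟩, ⟨g, .inr h⟩, ih h]

lemma mem_h3 {v : List Γ} {z : Ltr n} (h : z ∈ (h3 v : List (Ltr n))) :
    ∃ g, z = sub 0 g := by
  induction v with
  | nil => simp at h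
  | cons g v ih =>
    simp at h
    obtain h | h := h
    exacts [⟨g, h⟩, ih h]

lemma h3_append_split {v : List Γ} {e a b : List (Ltr n)} {g : Γ} (he : ∀ g, sub 0 g ∉ e)
    (h : a ++ sub 0 g :: b = h3 v ++ e) : ∃ v', b = h3 v' ++ e := by
  induction v generalizing a with
  | nil => exact absurd (by rw [← List.nil_append e, ← h3_nil, ← h]; simp) (he g)
  | cons g' v ih =>
    cases a with
    | nil =>
      simp at h
      exact ⟨v, h.2⟩
    | cons z a => exact ih (List.cons.inj (by simpa using h)).2

lemma h2_append_split_zero {v : List Γ} {e a b : List (Ltr n)} {g : Γ} (he : ∀ g, sub 0 g ∉ e)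
    (h : a ++ sub 0 g :: b = h2 v ++ e) : ∃ v', b = sub 1 g :: (h2 v' ++ e) := by
  induction v generalizing a with
  | nil => exact absurd (by rw [← List.nil_append e, ← h2_nil, ← h]; simp) (he g)
  | cons g' v ih =>
    rcases a with _ | ⟨z, _ | ⟨z', a⟩⟩
    · simp at h
      exact ⟨v, by simp [h]⟩
    · simp at h
    · simp at h
      exact ih h.2.2

lemma h2_append_split_one {v : List Γ} {e a b : List (Ltr n)} {g : Γ} (he : ∀ g, sub 1 g ∉ e)
    (h : a ++ sub 1 g :: b = h2 v ++ e) : ∃ v', b = h2 v' ++ e := by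
  induction v generalizing a with
  | nil => exact absurd (by rw [← List.nil_append e, ← h2_nil, ← h]; simp) (he g)
  | cons g' v ih =>
    rcases a with _ | ⟨z, _ | ⟨z', a⟩⟩
    · simp at h
    · simp at h
      exact ⟨v, h.2.2⟩
    · simp at h
      exact ih h.2.2

lemma next_h3_of_stack_one {v : List Γ} {e a b : List (Ltr n)} {z : Ltr n}
    (hz : z = Ltr.cent1 ∨ ∃ g, z = sub 0 g) (he : ∀ t ∈ e, t = Ltr.B ∨ ∃ i, t = Ltr.c i)
    (h : a ++ z :: b = h3 v ++ e) : ∃ v', b = h3 v' ++ e := by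
  obtain rfl | ⟨g, rfl⟩ := hz
  · have : Ltr.cent1 ∈ h3 v ++ e := by simp [← h]
    obtain H | H := List.mem_append.1 this
    · simpa using mem_h3 H
    · simpa using he _ H
  · exact h3_append_split (fun g hg => by simpa using he _ hg) h

lemma next_h2_of_stack_one {v : List Γ} {e a b : List (Ltr n)} {z : Ltr n}
    (hz : z = Ltr.cent1 ∨ ∃ g, z = sub 0 g) (he : ∀ t ∈ e, t = Ltr.B ∨ ∃ i, t = Ltr.c i)
    (h : a ++ z :: b = h2 v ++ e) : ∃ g b', b = sub 1 g :: b' := by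
  obtain rfl | ⟨g, rfl⟩ := hz
  · have : Ltr.cent1 ∈ h2 v ++ e := by simp [← h]
    obtain H | H := List.mem_append.1 this
    · simpa using mem_h2 H
    · simpa using he _ H
  · obtain ⟨v', h⟩ := h2_append_split_zero (fun g hg => by simpa using he _ hg) h
    exact ⟨g, _, h⟩

lemma not_h3_of_stack_two {v : List Γ} {e a b : List (Ltr n)} {z : Ltr n}
    (hz : z = Ltr.cent2 ∨ ∃ g, z = sub 1 g) (he : ∀ t ∈ e, t = Ltr.B ∨ ∃ i, t = Ltr.c i) :
    a ++ z :: b ≠ h3 v ++ e := by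
  intro h
  have : z ∈ h3 v ++ e := by simp [← h]
  obtain H | H := List.mem_append.1 this
  · obtain rfl | ⟨g, rfl⟩ := hz <;> simpa using mem_h3 H
  · obtain rfl | ⟨g, rfl⟩ := hz <;> simpa using he _ H

lemma next_h2_of_stack_two {v : List Γ} {e a b : List (Ltr n)} {z : Ltr n}
    (hz : z = Ltr.cent2 ∨ ∃ g, z = sub 1 g) (he : ∀ t ∈ e, t = Ltr.B ∨ ∃ i, t = Ltr.c i)
    (h : a ++ z :: b = h2 v ++ e) : ∃ v', b = h2 v' ++ e := by
  obtain rfl | ⟨g, rfl⟩ := hz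
  · have : Ltr.cent2 ∈ h2 v ++ e := by simp [← h]
    obtain H | H := List.mem_append.1 this
    · simpa using mem_h2 H
    · simpa using he _ H
  · exact h2_append_split_one (fun g hg => by simpa using he _ hg) h

/-- The continuation of a redex after a letter on top of a stack `¢₁ h₃(w)`. -/
lemma _root_.SRule.after_stack_one {a b : List (Ltr n)} {z : Ltr n}
    (h : SRule n x y (a ++ z :: b) r) (hz : z = Ltr.cent1 ∨ ∃ g, z = sub 0 g) :
    (∃ g, b = [sub 0 g, sub 1 g, sub 2 g]) ∨ (∃ g b', b = sub 1 g :: b') ∨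
      (∃ v i, b = h3 v ++ [Ltr.B, Ltr.c i]) ∨ ∃ v, b = h3 v ++ [Ltr.c (Fin.last (n + 1))] := by
  generalize hl : a ++ z :: b = l at h
  cases h with
  | I1 =>
    right; right; left
    rcases a with _ | ⟨z', a⟩
    · exact ⟨x 0, 0, by simpa using (List.cons.inj hl).2⟩
    · obtain ⟨v, h⟩ := next_h3_of_stack_one (v := x 0) (e := [Ltr.B, Ltr.c 0]) hz (by simp)
        (List.cons.inj hl).2
      exact ⟨v, 0, h⟩
  | II1 i =>
    obtain ⟨v, h⟩ := next_h3_of_stack_one hz (by simp) hl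
    exact .inr (.inr (.inl ⟨v, i, h⟩))
  | III1 =>
    obtain ⟨v, h⟩ := next_h3_of_stack_one hz (by simp) hl
    exact .inr (.inr (.inr ⟨v, h⟩))
  | I2 =>
    rcases a with _ | ⟨z', a⟩
    · obtain rfl | ⟨g, rfl⟩ := hz <;> simp at hl
    · exact .inr (.inl (next_h2_of_stack_one (v := y 0) (e := [Ltr.c 0]) hz (by simp)
        (List.cons.inj hl).2))
  | II2 => exact .inr (.inl (next_h2_of_stack_one hz (by simp) hl))
  | III2 => exact .inr (.inl (next_h2_of_stack_one hz (by simp) hl))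
  | _ =>
    obtain rfl | ⟨g, rfl⟩ := hz <;>
    rcases a with _ | ⟨_, _ | ⟨_, _ | ⟨_, _ | ⟨_, _ | ⟨_, a⟩⟩⟩⟩⟩ <;> simp at hl <;> simp [hl]

/-- The continuation of a redex after a letter on top of a stack `¢₂ h₂(w)`. -/
lemma _root_.SRule.after_stack_two {a b : List (Ltr n)} {z : Ltr n}
    (h : SRule n x y (a ++ z :: b) r) (hz : z = Ltr.cent2 ∨ ∃ g, z = sub 1 g) :
    (∃ g b', b = sub 0 g :: sub 1 g :: b') ∨ (∃ g b', b = sub 2 g :: b') ∨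
      ∃ i b', b = Ltr.c i :: b' := by
  have key : ∀ (v : List Γ) i (e : List (Ltr n)), b = h2 v ++ Ltr.c i :: e →
      (∃ g b', b = sub 0 g :: sub 1 g :: b') ∨ (∃ g b', b = sub 2 g :: b') ∨
        ∃ i b', b = Ltr.c i :: b' := by
    rintro (_ | ⟨g, v⟩) i e rfl
    · exact .inr (.inr ⟨i, e, rfl⟩)
    · exact .inl ⟨g, _, by simp; rfl⟩
  generalize hl : a ++ z :: b = l at h
  cases h with
  | I1 =>
    rcases a with _ | ⟨z', a⟩
    · obtain rfl | ⟨g, rfl⟩ := hz <;> simp at hl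
    · exact absurd (List.cons.inj hl).2 (not_h3_of_stack_two (v := x 0) hz (by simp))
  | II1 i => exact absurd hl (not_h3_of_stack_two hz (by simp))
  | III1 => exact absurd hl (not_h3_of_stack_two hz (by simp))
  | I2 =>
    rcases a with _ | ⟨z', a⟩
    · exact key (y 0) 0 [] (by simpa using (List.cons.inj hl).2)
    · obtain ⟨v, h⟩ := next_h2_of_stack_two (v := y 0) (e := [Ltr.c 0]) hz (by simp)
        (List.cons.inj hl).2
      exact key _ _ _ h
  | II2 =>
    obtain ⟨v, h⟩ := next_h2_of_stack_two hz (by simp) hl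
    exact key _ _ _ h
  | III2 =>
    obtain ⟨v, h⟩ := next_h2_of_stack_two hz (by simp) hl
    exact key _ _ _ h
  | _ =>
    obtain rfl | ⟨g, rfl⟩ := hz <;>
    rcases a with _ | ⟨_, _ | ⟨_, _ | ⟨_, _ | ⟨_, _ | ⟨_, a⟩⟩⟩⟩⟩ <;> simp at hl <;> simp [hl]

lemma append_cons_inj {α : Type*} {a b a' b' : List α} {t : α} (h : a ++ t :: b = a' ++ t :: b')
    (ha' : t ∉ a') (hb' : t ∉ b') : a = a' ∧ b = b' := by
  obtain ⟨h1, -, h2⟩ := (List.append_cons_inj_of_notMem ha' hb').1 h.symm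
  exact ⟨h1.symm, h2.symm⟩

lemma notMem_h2_c (v : List Γ) (i : Fin (n + 2)) : Ltr.c i ∉ h2 v := fun h => by
  simpa using mem_h2 h

lemma notMem_h3_c (v : List Γ) (i : Fin (n + 2)) : Ltr.c i ∉ h3 v := fun h => by
  simpa using mem_h3 h

lemma notMem_h2_B (v : List Γ) : (Ltr.B : Ltr n) ∉ h2 v := fun h => by
  simpa using mem_h2 h

lemma notMem_h3_B (v : List Γ) : (Ltr.B : Ltr n) ∉ h3 v := fun h => by
  simpa using mem_h3 h

lemma _root_.SRule.after_B {a b : List (Ltr n)} {t : Ltr n}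
    (h : SRule n x y (a ++ Ltr.B :: t :: b) r) : ∃ i, t = Ltr.c i := by
  generalize hl : a ++ Ltr.B :: t :: b = l at h
  cases h with
  | I1 =>
    have := append_cons_inj (a' := Ltr.cent1 :: h3 (x 0)) (b' := [Ltr.c 0]) (by simpa using hl)
      (by simp [notMem_h3_B]) (by simp)
    exact ⟨0, by simpa using congrArg List.head? this.2⟩
  | II1 i =>
    have := append_cons_inj hl (notMem_h3_B _) (by simp)
    exact ⟨i, by simpa using congrArg List.head? this.2⟩
  | II2 i =>
    have := append_cons_inj (a' := h2 (y i) ++ [Ltr.c i]) (b' := []) (by simpa using hl)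
      (by simp [notMem_h2_B]) (by simp)
    simp at this
  | III2 =>
    have := append_cons_inj (a' := h2 (y (Fin.last _)) ++ [Ltr.c (Fin.last _)]) (b' := [])
      (by simpa using hl) (by simp [notMem_h2_B]) (by simp)
    simp at this
  | III1 =>
    have : Ltr.B ∈ (h3 (x (Fin.last (n + 1))) ++ [Ltr.c (Fin.last (n + 1))] : List (Ltr n)) := by
      simp [← hl]
    simp [notMem_h3_B] at this
  | I2 =>
    have : Ltr.B ∈ ([Ltr.cent2] ++ h2 (y 0) ++ [Ltr.c 0] : List (Ltr n)) := by rw [← hl]; simp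
    simp [notMem_h2_B] at this
  | D1 | D2 | D3 | D4 =>
    have := congrArg (Ltr.B ∈ ·) hl
    simp at this

/-- The rules whose left-hand side contains the letter `c i`. -/
lemma _root_.SRule.cases_c {a b : List (Ltr n)} {i : Fin (n + 2)}
    (h : SRule n x y (a ++ Ltr.c i :: b) r) : r = [] ∧
      (b = [] ∧ (i = 0 ∧ (a = Ltr.cent1 :: (h3 (x 0) ++ [Ltr.B]) ∨ a = Ltr.cent2 :: h2 (y 0)) ∨
          (1 ≤ (i : ℕ) ∧ (i : ℕ) ≤ n) ∧ a = h3 (x i) ++ [Ltr.B] ∨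
          i = Fin.last (n + 1) ∧ a = h3 (x i)) ∨
        b = [Ltr.B] ∧ ((1 ≤ (i : ℕ) ∧ (i : ℕ) ≤ n) ∨ i = Fin.last (n + 1)) ∧ a = h2 (y i)) := by
  generalize hl : a ++ Ltr.c i :: b = l at h
  have hi : Ltr.c i ∈ l := by simp [← hl]
  cases h with
  | I1 =>
    obtain rfl : i = 0 := by simpa [notMem_h3_c] using hi
    have := append_cons_inj (a' := Ltr.cent1 :: (h3 (x 0) ++ [Ltr.B])) (b' := [])
      (by simpa using hl) (by simp [notMem_h3_c]) (by simp)
    simp [this]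
  | I2 =>
    obtain rfl : i = 0 := by simpa [notMem_h2_c] using hi
    have := append_cons_inj (a' := Ltr.cent2 :: h2 (y 0)) (b' := [])
      (by simpa using hl) (by simp [notMem_h2_c]) (by simp)
    simp [this]
  | II1 j h1 hn =>
    obtain rfl : i = j := by simpa [notMem_h3_c] using hi
    have := append_cons_inj (a' := h3 (x i) ++ [Ltr.B]) (b' := [])
      (by simpa using hl) (by simp [notMem_h3_c]) (by simp)
    simp [this, h1, hn]
  | II2 j h1 hn =>
    obtain rfl : i = j := by simpa [notMem_h2_c] using hi
    have := append_cons_inj hl (by simp [notMem_h2_c]) (by simp)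
    simp [this, h1, hn]
  | III1 =>
    obtain rfl : i = Fin.last _ := by simpa [notMem_h3_c] using hi
    have := append_cons_inj hl (by simp [notMem_h3_c]) (by simp)
    simp [this]
  | III2 =>
    obtain rfl : i = Fin.last _ := by simpa [notMem_h2_c] using hi
    have := append_cons_inj hl (by simp [notMem_h2_c]) (by simp)
    simp [this]
  | D1 | D2 | D3 | D4 => simp at hi

lemma cent1_h3_split {p : List (Ltr n)} {v w : List Γ} (h : Ltr.cent1 :: h3 w = p ++ h3 v) :
    ∃ w', w = w' ++ v ∧ p = Ltr.cent1 :: h3 w' := by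
  induction v using List.reverseRecOn generalizing w with
  | nil => exact ⟨w, by simp, by simpa using h.symm⟩
  | append_singleton v g ih =>
    obtain rfl | ⟨w, g', rfl⟩ := List.eq_nil_or_concat w
    · have := congrArg List.reverse h
      simp at this
    · have : (Ltr.cent1 :: h3 w) ++ [sub 0 g'] = (p ++ h3 v) ++ [sub 0 g] := by simpa using h
      obtain ⟨h1, h2⟩ := List.append_inj' this rfl
      obtain ⟨w', rfl, rfl⟩ := ih h1
      exact ⟨w', by simpa using h2, rfl⟩

lemma cent2_h2_split {p : List (Ltr n)} {v w : List Γ} (h : Ltr.cent2 :: h2 w = p ++ h2 v) :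
    ∃ w', w = w' ++ v ∧ p = Ltr.cent2 :: h2 w' := by
  induction v using List.reverseRecOn generalizing w with
  | nil => exact ⟨w, by simp, by simpa using h.symm⟩
  | append_singleton v g ih =>
    obtain rfl | ⟨w, g', rfl⟩ := List.eq_nil_or_concat w
    · have := congrArg List.reverse h
      simp at this
    · have : (Ltr.cent2 :: h2 w) ++ [sub 0 g', sub 1 g'] =
          (p ++ h2 v) ++ [sub 0 g, sub 1 g] := by simpa using h
      obtain ⟨h1, h2⟩ := List.append_inj' this rfl
      obtain ⟨w', rfl, rfl⟩ := ih h1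
      exact ⟨w', by simpa using h2, rfl⟩

lemma last_stack_one {p : List (Ltr n)} {w : List Γ} {z : Ltr n}
    (h : Ltr.cent1 :: h3 w = p ++ [z]) : z = Ltr.cent1 ∨ ∃ g, z = sub 0 g := by
  have : z ∈ Ltr.cent1 :: h3 w := by simp [h]
  exact (List.mem_cons.1 this).imp_right mem_h3

lemma last_stack_two {p : List (Ltr n)} {w : List Γ} {z : Ltr n}
    (h : Ltr.cent2 :: h2 w = p ++ [z]) : z = Ltr.cent2 ∨ ∃ g, z = sub 1 g := by
  obtain rfl | ⟨w, g', rfl⟩ := List.eq_nil_or_concat w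
  · have := congrArg List.reverse h
    simp at this
    exact .inl this.1.symm
  · have := congrArg List.reverse h
    simp at this
    exact .inr ⟨g', this.1.symm⟩

lemma not_reducible_stack_one (hx : ∀ i, x i ≠ []) (hy : ∀ i, y i ≠ []) (w : List Γ) :
    ¬Reducible x y (Ltr.cent1 :: h3 w) :=
  not_reducible_of_isChain hx hy
    (by simpa using isChain_cent1_h3_append w (e := []) (by simp) (by simp))

lemma not_reducible_stack_one_B (hx : ∀ i, x i ≠ []) (hy : ∀ i, y i ≠ []) (w : List Γ) :
    ¬Reducible x y (Ltr.cent1 :: (h3 w ++ [Ltr.B])) :=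
  not_reducible_of_isChain hx hy
    (isChain_cent1_h3_append w (e := [Ltr.B]) (by simp) (by simp [Terminal]))

lemma not_reducible_stack_two (hx : ∀ i, x i ≠ []) (hy : ∀ i, y i ≠ []) (w : List Γ) :
    ¬Reducible x y (Ltr.cent2 :: h2 w) :=
  not_reducible_of_isChain hx hy
    (by simpa using isChain_cent2_h2_append w (e := []) (by simp) (by simp))

lemma exists_redex {e e' : Ltr n} {s s' u : List (Ltr n)} (hne : e ≠ e')
    (hs : ¬Reducible x y (e :: s)) (hs' : ¬Reducible x y (e' :: s')) (hu : ¬Reducible x y u)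
    (h : nf x y (e :: s ++ u) = nf x y (e' :: s' ++ u)) :
    ∃ p a z b q r, SRule n x y (a ++ z :: b) r ∧ e :: s = p ++ (a ++ [z]) ∧ b ≠ [] ∧
      u = b ++ q := by
  obtain ⟨p, a, b, q, r, ha, hb, hr, hs, hu⟩ :=
    exists_straddle hs hu (reducible_of_nf_eq hne hs' h)
  obtain ⟨a, z, rfl⟩ := (List.eq_nil_or_concat a).resolve_left ha
  exact ⟨p, a, z, b, q, r, by simpa using hr, by simpa using hs, hb, hu⟩

lemma nf_cent1_h1 (hx : ∀ i, x i ≠ []) (hy : ∀ i, y i ≠ []) (w : List Γ) (g : Γ)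
    (u : List (Ltr n)) :
    nf x y (Ltr.cent1 :: h3 w ++ (h1 [g] ++ u)) = nf x y (Ltr.cent1 :: h3 (w ++ [g]) ++ u) := by
  obtain rfl | ⟨w, g', rfl⟩ := List.eq_nil_or_concat w
  · simpa using nf_rule hx hy (.D1 g) [] u
  · simpa using nf_rule hx hy (.D4 g' g) (Ltr.cent1 :: h3 w) u

lemma nf_cent2_h1 (hx : ∀ i, x i ≠ []) (hy : ∀ i, y i ≠ []) (w : List Γ) (g : Γ)
    (u : List (Ltr n)) :
    nf x y (Ltr.cent2 :: h2 w ++ (h1 [g] ++ u)) = nf x y (Ltr.cent2 :: h2 (w ++ [g]) ++ u) := by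
  obtain rfl | ⟨w, g', rfl⟩ := List.eq_nil_or_concat w
  · simpa using nf_rule hx hy (.D2 g) [] u
  · simpa using nf_rule hx hy (.D3 g' g) (Ltr.cent2 :: h2 w) u

/-- Once the last domino has been read off, the remaining input reads off the other ones. -/
lemma exists_dominoes (hx : ∀ i, x i ≠ []) (hy : ∀ i, y i ≠ []) (u : List (Ltr n))
    (w v : List Γ) (hu : ¬Reducible x y u)
    (h : nf x y (Ltr.cent1 :: (h3 w ++ [Ltr.B]) ++ u) = nf x y (Ltr.cent2 :: h2 v ++ u)) :
    ∃ L : List (Fin (n + 2)), (∀ i ∈ L, 1 ≤ (i : ℕ) ∧ (i : ℕ) ≤ n) ∧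
      w = x 0 ++ L.flatMap x ∧ v = y 0 ++ L.flatMap y := by
  obtain ⟨k, hk⟩ : ∃ k, u.length ≤ k := ⟨_, le_rfl⟩
  induction k generalizing u w v with
  | zero =>
    obtain rfl : u = [] := by simpa using hk
    obtain ⟨p, a, z, b, q, r, -, -, hb, e⟩ := exists_redex (by simp)
      (not_reducible_stack_one_B hx hy w) (not_reducible_stack_two hx hy v) hu h
    exact absurd (List.append_eq_nil_iff.1 e.symm).1 hb
  | succ k ih =>
    obtain ⟨p, a, z, b, q, r, hr, hs, hb, rfl⟩ := exists_redex (by simp)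
      (not_reducible_stack_one_B hx hy w) (not_reducible_stack_two hx hy v) hu h
    obtain ⟨p', a', z', b', q', r', hr', hs', hb', e⟩ := exists_redex (by simp)
      (not_reducible_stack_two hx hy v) (not_reducible_stack_one_B hx hy w) hu h.symm
    obtain ⟨hpa, rfl⟩ : Ltr.cent1 :: h3 w = p ++ a ∧ Ltr.B = z := by
      have : (Ltr.cent1 :: h3 w) ++ [Ltr.B] = (p ++ a) ++ [z] := by simpa using hs
      simpa using List.append_inj' this rfl
    obtain ⟨t, b, rfl⟩ := List.exists_cons_of_ne_nil hb
    obtain ⟨i, rfl⟩ := hr.after_B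
    obtain ⟨t', b', rfl⟩ := List.exists_cons_of_ne_nil hb'
    obtain rfl : Ltr.c i = t' := (List.cons.inj e).1
    have hz' := last_stack_two (p := p' ++ a') (by simpa using hs')
    have hzB : z' ≠ Ltr.B := by obtain rfl | ⟨g, rfl⟩ := hz' <;> simp
    have h2B : ∀ v, a ++ [Ltr.B] ≠ h2 v := fun v H => notMem_h2_B v (by rw [← H]; simp)
    have h3B : ∀ v, a ++ [Ltr.B] ≠ h3 v := fun v H => notMem_h3_B v (by rw [← H]; simp)
    have h2B' : ∀ v, a ++ [Ltr.B] ≠ Ltr.cent2 :: h2 v := fun v H => by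
      have : Ltr.B ∈ (Ltr.cent2 :: h2 v : List (Ltr n)) := by rw [← H]; simp
      simp [notMem_h2_B] at this
    have h3' : ∀ v, a' ++ [z'] ≠ h3 v := fun v H =>
      not_h3_of_stack_two (a := a') (b := []) (v := v) (e := []) hz' (by simp) (by simpa using H)
    have hB' : ∀ v, a' ++ [z'] ≠ v ++ [Ltr.B] := fun v H =>
      hzB (by simpa using (List.append_inj' H rfl).2)
    have hB'' : ∀ v, a' ++ [z'] ≠ Ltr.cent1 :: (v ++ [Ltr.B]) := fun v => hB' (_ :: v)
    have H := SRule.cases_c (a := a ++ [Ltr.B]) (b := b) (i := i) (r := r) (by simpa using hr)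
    have H' := SRule.cases_c (a := a' ++ [z']) (b := b') (i := i) (r := r') (by simpa using hr')
    simp only [h2B, h3B, h2B', h3', hB', hB'', and_false, or_false, false_or] at H H'
    rw [← List.cons_append, List.append_left_inj] at H
    obtain ⟨rfl, rfl, H⟩ := H
    obtain ⟨rfl, H'⟩ := H'
    obtain ⟨rfl, rfl⟩ | ⟨hi, ha⟩ := H
    · obtain ⟨rfl, -, ha'⟩ : b' = [] ∧ (0 : Fin (n + 2)) = 0 ∧
          a' ++ [z'] = Ltr.cent2 :: h2 (y 0) := by simpa [Fin.ext_iff] using H'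
      obtain ⟨w', rfl, hp⟩ := cent1_h3_split (p := p ++ [Ltr.cent1]) (v := x 0) (w := w)
        (by simpa using hpa)
      obtain ⟨v', rfl, hp'⟩ := cent2_h2_split (p := p' ++ [Ltr.cent2]) (v := y 0) (w := v)
        (by rw [hs', ha']; simp)
      have hw : w' = [] := by
        cases w' using List.reverseRecOn with
        | nil => rfl
        | append_singleton w' g =>
          have := congrArg List.reverse hp
          simp at this
      have hv : v' = [] := by
        cases v' using List.reverseRecOn with
        | nil => rfl
        | append_singleton v' g =>
          have := congrArg List.reverse hp'
          simp at this
      exact ⟨[], by simp, by simp [hw], by simp [hv]⟩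
    · obtain rfl := List.append_cancel_right ha
      have hi0 : i ≠ 0 := by rintro rfl; simp at hi
      have hil : i ≠ Fin.last (n + 1) := by rintro rfl; simp at hi
      obtain ⟨rfl, ha'⟩ : b' = [Ltr.B] ∧ a' ++ [z'] = h2 (y i) := by
        simpa [hi0, hil, hi] using H'
      rw [ha'] at hs'
      obtain ⟨w', rfl, rfl⟩ := cent1_h3_split hpa
      obtain ⟨v', rfl, rfl⟩ := cent2_h2_split hs'
      obtain rfl : q = Ltr.B :: q' := by simpa using e
      have e1 := nf_rule hx hy (.II1 i hi.1 hi.2) (Ltr.cent1 :: h3 w') (Ltr.B :: q')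
      have e2 := nf_rule hx hy (.II2 i hi.1 hi.2) (Ltr.cent2 :: h2 v') q'
      obtain ⟨L, hL, rfl, rfl⟩ := ih q' w' v'
        (fun H => hu (by simpa using H.append_left [Ltr.c i, Ltr.B]))
        (by simpa using e1.symm.trans (.trans (by simpa using h) e2)) (by simp at hk; omega)
      refine ⟨L ++ [i], fun j hj => ?_, by simp, by simp⟩
      obtain hj | rfl : j ∈ L ∨ j = i := by simpa using hj
      exacts [hL j hj, hi]

/-- Both stacks read a word `h₁(w)`, and then the last domino. -/
lemma solvable_of_nf_eq (hx : ∀ i, x i ≠ []) (hy : ∀ i, y i ≠ []) (u : List (Ltr n))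
    (w : List Γ) (hu : ¬Reducible x y u)
    (h : nf x y (Ltr.cent1 :: h3 w ++ u) = nf x y (Ltr.cent2 :: h2 w ++ u)) :
    GPCPSolvable n x y := by
  by_cases hg : ∃ g u', u = h1 [g] ++ u'
  · obtain ⟨g, u', rfl⟩ := hg
    rw [nf_cent1_h1 hx hy, nf_cent2_h1 hx hy] at h
    exact solvable_of_nf_eq hx hy u' (w ++ [g]) (fun H => hu (H.append_left _)) h
  obtain ⟨p, a, z, b, q, r, hr, hs, hb, rfl⟩ := exists_redex (by simp)
    (not_reducible_stack_one hx hy w) (not_reducible_stack_two hx hy w) hu h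
  obtain ⟨p', a', z', b', q', r', hr', hs', hb', e⟩ := exists_redex (by simp)
    (not_reducible_stack_two hx hy w) (not_reducible_stack_one hx hy w) hu h.symm
  have hz := last_stack_one (p := p ++ a) (by simpa using hs)
  have hz' := last_stack_two (p := p' ++ a') (by simpa using hs')
  obtain ⟨rfl, b'', rfl⟩ : b = [Ltr.c (Fin.last (n + 1))] ∧
      ∃ b'', b' = Ltr.c (Fin.last (n + 1)) :: b'' := by
    obtain ⟨g, rfl⟩ | ⟨g, b, rfl⟩ | ⟨v, i, rfl⟩ | ⟨v, rfl⟩ := hr.after_stack_one hz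
    · exact absurd ⟨g, q, by simp⟩ hg
    · obtain ⟨g', b', rfl⟩ | ⟨g', b', rfl⟩ | ⟨j, b', rfl⟩ := hr'.after_stack_two hz' <;> simp at e
    · obtain ⟨g', b', rfl⟩ | ⟨g', b', rfl⟩ | ⟨j, b', rfl⟩ := hr'.after_stack_two hz' <;>
        rcases v with _ | ⟨g₁, _ | ⟨g₂, v⟩⟩ <;> simp at e
    · obtain ⟨g', b', rfl⟩ | ⟨g', b', rfl⟩ | ⟨j, b', rfl⟩ := hr'.after_stack_two hz' <;>
        rcases v with _ | ⟨g₁, _ | ⟨g₂, v⟩⟩ <;> simp at e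
      simp [e]
  have H := SRule.cases_c (a := a ++ [z]) (by simpa using hr)
  have H' := SRule.cases_c (a := a' ++ [z']) (by simpa using hr')
  have h3' : ∀ v e, (∀ t ∈ e, t = Ltr.B ∨ ∃ i, t = Ltr.c i) → a' ++ [z'] ≠ h3 v ++ e :=
    fun v e he => not_h3_of_stack_two hz' he
  have h3'' := h3' (x (Fin.last (n + 1))) [] (by simp)
  rw [List.append_nil] at h3''
  obtain ⟨rfl, ha⟩ : r = [] ∧ a ++ [z] = h3 (x (Fin.last (n + 1))) := by
    simpa [Fin.ext_iff] using H
  obtain ⟨rfl, rfl, ha'⟩ : r' = [] ∧ b'' = [Ltr.B] ∧ a' ++ [z'] = h2 (y (Fin.last (n + 1))) := by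
    simpa [Fin.ext_iff, h3''] using H'
  rw [ha] at hs
  rw [ha'] at hs'
  obtain ⟨w₁, hw₁, rfl⟩ := cent1_h3_split hs
  obtain ⟨w₂, hw₂, rfl⟩ := cent2_h2_split hs'
  obtain rfl : q = Ltr.B :: q' := by simpa using e
  have e1 := nf_rule hx hy .III1 (Ltr.cent1 :: h3 w₁) (Ltr.B :: q')
  have e2 := nf_rule hx hy .III2 (Ltr.cent2 :: h2 w₂) q'
  obtain ⟨L, hL, rfl, rfl⟩ := exists_dominoes hx hy q' w₁ w₂
    (fun H => hu (by simpa using H.append_left [Ltr.c (Fin.last (n + 1)), Ltr.B]))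
    (by rw [hs, hs'] at h; simpa using e1.symm.trans (.trans (by simpa using h) e2))
  exact ⟨L, hL, hw₁.symm.trans hw₂⟩
termination_by u.length
decreasing_by subst_vars; simp; omega

lemma OneStep.length_lt {u v : List (Ltr n)} (h : OneStep (SSys n x y) u v) :
    v.length < u.length := by
  obtain ⟨p, q, l, r, h, rfl, rfl⟩ := h
  obtain ⟨m, hm, e⟩ := SRule.exists_eq_append h
  obtain rfl : l = r ++ m := e
  have := List.length_pos_of_ne_nil hm
  simp
  omega

/-- A solution of the common equation with irreducible `W₁`. -/
lemma exists_not_reducible (hx : ∀ i, x i ≠ []) (hy : ∀ i, y i ≠ []) (W : List (Ltr n))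
    (h : nf x y (Ltr.cent1 :: W) = nf x y (Ltr.cent2 :: W)) :
    ∃ u, ¬Reducible x y u ∧ nf x y (Ltr.cent1 :: u) = nf x y (Ltr.cent2 :: u) := by
  by_cases hW : Reducible x y W
  · obtain ⟨p, l, q, r, hr, rfl⟩ := hW
    have : (p ++ r ++ q).length < (p ++ l ++ q).length :=
      OneStep.length_lt ⟨p, q, l, r, hr, rfl, rfl⟩
    refine exists_not_reducible hx hy (p ++ r ++ q) ?_
    have e1 := nf_rule hx hy hr (Ltr.cent1 :: p) q
    have e2 := nf_rule hx hy hr (Ltr.cent2 :: p) q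
    exact e1.symm.trans (.trans h e2)
  · exact ⟨W, hW, h⟩
termination_by W.length
decreasing_by subst_vars; exact this

lemma thueCong_refl {α : Type*} (R : Set (List α × List α)) (u : List α) : ThueCong R u u :=
  .refl u

lemma thueCong_trans {α : Type*} {R : Set (List α × List α)} {u v w : List α}
    (h : ThueCong R u v) (h' : ThueCong R v w) : ThueCong R u w :=
  .trans _ _ _ h h'

lemma thueCong_rule (h : SRule n x y l r) (p q : List (Ltr n)) :
    ThueCong (SSys n x y) (p ++ l ++ q) (p ++ r ++ q) :=
  .rel _ _ ⟨p, q, l, r, h, rfl, rfl⟩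

lemma thueCong_cent1_h1 (w v : List Γ) (u : List (Ltr n)) :
    ThueCong (SSys n x y) (Ltr.cent1 :: h3 w ++ (h1 v ++ u))
      (Ltr.cent1 :: h3 (w ++ v) ++ u) := by
  induction v generalizing w with
  | nil => simpa using thueCong_refl _ _
  | cons g v ih =>
    refine thueCong_trans ?_ (by simpa using ih (w ++ [g]))
    obtain rfl | ⟨w, g', rfl⟩ := List.eq_nil_or_concat w
    · simpa using thueCong_rule (.D1 g) [] (h1 v ++ u)
    · simpa using thueCong_rule (.D4 g' g) (Ltr.cent1 :: h3 w) (h1 v ++ u)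

lemma thueCong_cent2_h1 (w v : List Γ) (u : List (Ltr n)) :
    ThueCong (SSys n x y) (Ltr.cent2 :: h2 w ++ (h1 v ++ u))
      (Ltr.cent2 :: h2 (w ++ v) ++ u) := by
  induction v generalizing w with
  | nil => simpa using thueCong_refl _ _
  | cons g v ih =>
    refine thueCong_trans ?_ (by simpa using ih (w ++ [g]))
    obtain rfl | ⟨w, g', rfl⟩ := List.eq_nil_or_concat w
    · simpa using thueCong_rule (.D2 g) [] (h1 v ++ u)
    · simpa using thueCong_rule (.D3 g' g) (Ltr.cent2 :: h2 w) (h1 v ++ u)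

/-- The part `c_{i_k} B ⋯ c_{i_1} B c_0` of `W₁`. -/
def indexWord (L : List (Fin (n + 2))) : List (Ltr n) :=
  L.reverse.flatMap (fun i => [Ltr.c i, Ltr.B]) ++ [Ltr.c 0]

lemma thueCong_cent1_indexWord (L : List (Fin (n + 2)))
    (hL : ∀ i ∈ L, 1 ≤ (i : ℕ) ∧ (i : ℕ) ≤ n) :
    ThueCong (SSys n x y)
      (Ltr.cent1 :: h3 (x 0 ++ L.flatMap x) ++ Ltr.B :: indexWord L) [] := by
  induction L using List.reverseRecOn with
  | nil => simpa [indexWord] using thueCong_rule (.I1 (x := x) (y := y)) [] []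
  | append_singleton L i ih =>
    have hi := hL i (by simp)
    refine thueCong_trans ?_ (ih fun j hj => hL j (by simp [hj]))
    simpa [indexWord] using thueCong_rule (y := y) (.II1 i hi.1 hi.2)
      (Ltr.cent1 :: h3 (x 0 ++ L.flatMap x)) (Ltr.B :: indexWord L)

lemma thueCong_cent2_indexWord (L : List (Fin (n + 2)))
    (hL : ∀ i ∈ L, 1 ≤ (i : ℕ) ∧ (i : ℕ) ≤ n) :
    ThueCong (SSys n x y) (Ltr.cent2 :: h2 (y 0 ++ L.flatMap y) ++ indexWord L) [] := by
  induction L using List.reverseRecOn with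
  | nil => simpa [indexWord] using thueCong_rule (.I2 (x := x) (y := y)) [] []
  | append_singleton L i ih =>
    have hi := hL i (by simp)
    refine thueCong_trans ?_ (ih fun j hj => hL j (by simp [hj]))
    simpa [indexWord] using thueCong_rule (x := x) (.II2 i hi.1 hi.2)
      (Ltr.cent2 :: h2 (y 0 ++ L.flatMap y)) (indexWord L)

end CommonEquation

open CommonEquation in
/-- There exist `W₁, W₂ ∈ Σ̂*` with `¢₁ W₁ ↔*_S W₂` and `¢₂ W₁ ↔*_S W₂` iff the
GPCP instance has a solution (correctness of the reduction for the Common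
Equation problem). -/
theorem ce_reduction_correct (n : ℕ) (x y : Fin (n + 2) → List Γ)
    (hx : ∀ i, x i ≠ []) (hy : ∀ i, y i ≠ []) :
    (∃ W1 W2 : List (Ltr n),
        ThueCong (SSys n x y) (Ltr.cent1 :: W1) W2 ∧
        ThueCong (SSys n x y) (Ltr.cent2 :: W1) W2) ↔
      GPCPSolvable n x y := by
  constructor
  · rintro ⟨W1, W2, e1, e2⟩
    obtain ⟨u, hu, h⟩ := exists_not_reducible hx hy W1
      ((nf_eq_of_thueCong hx hy e1).trans (nf_eq_of_thueCong hx hy e2).symm)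
    exact solvable_of_nf_eq hx hy u [] hu (by simpa using h)
  · rintro ⟨L, hL, e⟩
    refine ⟨h1 (x 0 ++ L.flatMap x ++ x (Fin.last (n + 1))) ++
      (Ltr.c (Fin.last (n + 1)) :: Ltr.B :: indexWord L), [], ?_, ?_⟩
    · refine thueCong_trans (by simpa using thueCong_cent1_h1 [] _ _)
        (thueCong_trans ?_ (thueCong_cent1_indexWord L hL))
      simpa using thueCong_rule (y := y) .III1
        (Ltr.cent1 :: h3 (x 0 ++ L.flatMap x)) (Ltr.B :: indexWord L)
    · rw [e]
      refine thueCong_trans (by simpa using thueCong_cent2_h1 [] _ _)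
        (thueCong_trans ?_ (thueCong_cent2_indexWord L hL))
      simpa using thueCong_rule (x := x) .III2
        (Ltr.cent2 :: h2 (y 0 ++ L.flatMap y)) (indexWord L)
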